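/- arXiv:2411.10439 — 3 statements merged into one kernel-verified Lean document; each statement's English description precedes it below -/
import Mathlib

section
/- Let p ∈ (0,∞). For every φ ∈ Cvx(ℝⁿ) with barycenter b(φ) = 0 and every y ∈ ℝⁿ, the classical Legendre transform satisfies φ^*(y) ≤ φ^{*,p}( ((1+p)/p)·y ) + (n/p)·log(1+p). In particular the same bound holds with φ^* replaced by φ^{*,q} for any q ∈ (p,∞). -/
open MeasureTheory Real Filter
open scoped ENNReal RealInnerProductSpace Classical

noncomputable section

abbrev Euc (n : ℕ) : Type := EuclideanSpace ℝ (Fin n)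

/-- `e^t` as an extended nonnegative real, for `t : EReal` (`e^{-∞}=0`, `e^{+∞}=∞`). -/
def erealExp (t : EReal) : ℝ≥0∞ :=
  if t = ⊥ then 0 else if t = ⊤ then ⊤ else ENNReal.ofReal (Real.exp t.toReal)

/-- The volume `V(f) = ∫ e^{-f}` of `f : ℝⁿ → ℝ ∪ {+∞}`, as an extended nonnegative real. -/
def VolE {n : ℕ} (f : Euc n → EReal) : ℝ≥0∞ := ∫⁻ x, erealExp (-(f x))

/-- The volume `V(f) = ∫ e^{-f}` as a real number. -/
def Vol {n : ℕ} (f : Euc n → EReal) : ℝ := (VolE f).toReal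

/-- `∫ e^{p⟨x,y⟩ - (p+1) f(x)} dx`. -/
def LpIntE {n : ℕ} (p : ℝ) (f : Euc n → EReal) (y : Euc n) : ℝ≥0∞ :=
  ∫⁻ x, erealExp (((p * ⟪x, y⟫ : ℝ) : EReal) - ((p + 1 : ℝ) : EReal) * f x)

/-- The `L^p`-Legendre transform
`f^{*,p}(y) = (1/p) log ( ∫ e^{p⟨x,y⟩ - (p+1) f(x)} dx / V(f) )`,
with value `+∞` when the integral diverges. -/
def LpStar {n : ℕ} (p : ℝ) (f : Euc n → EReal) (y : Euc n) : EReal :=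
  if LpIntE p f y = ⊤ then ⊤
  else (((1 / p) * Real.log ((LpIntE p f y).toReal / Vol f) : ℝ) : EReal)

/-- The `L^p`-Mahler integral `M_p(f) = V(f) · V(f^{*,p})`, as an extended nonnegative real. -/
def MpE {n : ℕ} (p : ℝ) (f : Euc n → EReal) : ℝ≥0∞ := VolE f * VolE (LpStar p f)

/-- The translate `(T_a f)(x) = f(x + a)`. -/
def Transl {n : ℕ} (a : Euc n) (f : Euc n → EReal) : Euc n → EReal := fun x => f (x + a)

/-- Convexity of an `ℝ ∪ {+∞}`-valued function. -/
def ConvexE {n : ℕ} (φ : Euc n → EReal) : Prop :=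
  ∀ x y : Euc n, ∀ l : ℝ, 0 ≤ l → l ≤ 1 →
    φ ((1 - l) • x + l • y) ≤ ((1 - l : ℝ) : EReal) * φ x + ((l : ℝ) : EReal) * φ y

/-- The class `Cvx(ℝⁿ)`: convex, lower semicontinuous functions `ℝⁿ → ℝ ∪ {+∞}`,
not identically `+∞`, with `0 < V(φ) < ∞`. -/
structure InCvx {n : ℕ} (φ : Euc n → EReal) : Prop where
  noBot : ∀ x, φ x ≠ ⊥
  convex : ConvexE φ
  lsc : LowerSemicontinuous φ
  proper : ∃ x, φ x ≠ ⊤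
  volPos : 0 < VolE φ
  volFin : VolE φ < ⊤

/-- The barycenter `b(g) = ∫ x e^{-g(x)} dx / V(g)`. -/
def bary {n : ℕ} (g : Euc n → EReal) : Euc n :=
  (Vol g)⁻¹ • ∫ x, (erealExp (-(g x))).toReal • x

/-- The classical Legendre transform `f^*(y) = sup_x (⟨x,y⟩ - f(x))`. -/
def Lstar {n : ℕ} (f : Euc n → EReal) (y : Euc n) : EReal :=
  ⨆ x : Euc n, (((⟪x, y⟫ : ℝ) : EReal) - f x)



lemma erealExp_eq (t : EReal) : erealExp t = EReal.exp t := by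
  unfold erealExp
  induction t using EReal.rec with
  | bot => simp
  | top => simp
  | coe a => simp

lemma erealExp_mono {s t : EReal} (h : s ≤ t) : erealExp s ≤ erealExp t := by
  rw [erealExp_eq, erealExp_eq]; exact EReal.exp_monotone h

lemma erealExp_coe (a : ℝ) : erealExp (a : EReal) = ENNReal.ofReal (Real.exp a) := by
  rw [erealExp_eq, EReal.exp_coe]

lemma erealExp_measurable : Measurable erealExp := by
  have h : erealExp = EReal.exp := funext erealExp_eq
  rw [h]; exact EReal.exp_monotone.measurable

lemma real_of_le {a : EReal} {b : ℝ} (ha : a ≠ ⊥) (h : a ≤ b) : ∃ r : ℝ, a = r ∧ r ≤ b := by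
  induction a using EReal.rec with
  | bot => exact absurd rfl ha
  | top => exact absurd h (by simp)
  | coe a => exact ⟨a, rfl, EReal.coe_le_coe_iff.1 h⟩

lemma lintegral_affine {n : ℕ} (G : Euc n → ℝ≥0∞) (hG : Measurable G) (s : ℝ) (hs : 0 < s)
    (v : Euc n) :
    ∫⁻ z, G (s • z + v) = ENNReal.ofReal ((s ^ n)⁻¹) * ∫⁻ x, G x := by
  have h1 : ∫⁻ z, G (s • z + v) = ∫⁻ w, G (w + v) ∂(Measure.map (s • ·) volume) := by
    rw [lintegral_map (by fun_prop) (by fun_prop)]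
  rw [h1, Measure.map_addHaar_smul _ hs.ne', lintegral_smul_measure, lintegral_add_right_eq_self]
  rw [finrank_euclideanSpace_fin, abs_of_pos (by positivity)]
  rfl

lemma bounded_of_finite {n : ℕ} (K : Set (Euc n)) (hK : Convex ℝ K) (x0 : Euc n) (r : ℝ)
    (hr : 0 < r) (hb : Metric.ball x0 r ⊆ K) (hfin : volume K < ⊤) :
    ∃ R : ℝ, 0 < R ∧ ∀ x ∈ K, ‖x - x0‖ < R := by
  set β : ℝ≥0∞ := volume (Metric.ball (0 : Euc n) (r/2)) with hβ
  have hβ0 : β ≠ 0 := (Metric.measure_ball_pos _ _ (by positivity)).ne'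
  have hβt : β ≠ ⊤ := measure_ball_lt_top.ne
  obtain ⟨M, hM⟩ : ∃ M : ℝ, M = (volume K / β).toReal := ⟨_, rfl⟩
  have hM0 : 0 ≤ M := hM ▸ ENNReal.toReal_nonneg
  refine ⟨2 * r * (M + 1), by positivity, fun x hx => ?_⟩
  by_contra hcon
  push Not at hcon
  set d := ‖x - x0‖ with hd
  have hdpos : 0 < d := lt_of_lt_of_le (by positivity) hcon
  set N := ⌊d / (2 * r)⌋₊ with hN
  have hN1 : (N : ℝ) ≤ d / (2 * r) := Nat.floor_le (by positivity)
  have hN2 : d / (2 * r) < N + 1 := Nat.lt_floor_add_one _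
  let c : ℕ → Euc n := fun k => x0 + (k * r / d) • (x - x0)
  have hsub : ∀ k ∈ Finset.range (N + 1), Metric.ball (c k) (r / 2) ⊆ K := by
    intro k hk w hw
    have hkN : (k : ℝ) ≤ N := by
      have := Finset.mem_range.1 hk
      exact_mod_cast Nat.lt_succ_iff.1 this
    set t := k * r / d with ht
    have ht0 : 0 ≤ t := by positivity
    have ht1 : t ≤ 1 / 2 := by
      have h := hkN.trans hN1
      rw [le_div_iff₀ (by positivity)] at h
      rw [ht, div_le_iff₀ hdpos]; linarith
    have h1t : 0 < 1 - t := by linarith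
    have hu : x0 + (1 - t)⁻¹ • (w - c k) ∈ K := by
      apply hb
      rw [Metric.mem_ball, dist_eq_norm, add_sub_cancel_left, norm_smul, Real.norm_eq_abs,
        abs_of_pos (by positivity)]
      rw [Metric.mem_ball, dist_eq_norm] at hw
      rw [inv_mul_lt_iff₀ h1t]
      nlinarith
    have := hK hu hx h1t.le ht0 (by ring)
    convert! this using 1
    rw [smul_add, smul_smul, mul_inv_cancel₀ h1t.ne']
    simp only [c, ← ht]
    module
  have hdisj : Set.PairwiseDisjoint (↑(Finset.range (N + 1)))
      (fun k => Metric.ball (c k) (r / 2)) := by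
    intro i _ j _ hij
    apply Metric.ball_disjoint_ball
    rw [dist_eq_norm]
    have : c i - c j = (((i : ℝ) - j) * r / d) • (x - x0) := by
      simp only [c]; module
    rw [this, norm_smul, ← hd, Real.norm_eq_abs, abs_div, abs_mul, abs_of_pos hr,
      abs_of_pos hdpos, div_mul_cancel₀ _ hdpos.ne']
    have : (1 : ℝ) ≤ |(i : ℝ) - j| := by
      have h : (1 : ℤ) ≤ |(i : ℤ) - j| := Int.one_le_abs (by
        intro h; apply hij; have := sub_eq_zero.1 h; exact_mod_cast this)
      exact_mod_cast h
    nlinarith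
  have hmeas := measure_biUnion_finset (μ := volume) hdisj (fun k _ => measurableSet_ball)
  have hle : volume (⋃ k ∈ Finset.range (N+1), Metric.ball (c k) (r / 2)) ≤ volume K :=
    measure_mono (Set.iUnion₂_subset hsub)
  rw [hmeas] at hle
  have hsum : ∑ k ∈ Finset.range (N+1), volume (Metric.ball (c k) (r / 2))
      = ((N + 1 : ℕ) : ℝ≥0∞) * β := by
    rw [Finset.sum_congr rfl (fun k _ => Measure.addHaar_ball_center volume (c k) (r/2))]
    simp [hβ]
  rw [hsum] at hle
  have h3 : ((N + 1 : ℕ) : ℝ≥0∞) ≤ volume K / β := by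
    rw [ENNReal.le_div_iff_mul_le (Or.inl hβ0) (Or.inl hβt)]; exact hle
  have h4 := ENNReal.toReal_mono (ENNReal.div_ne_top hfin.ne hβ0) h3
  rw [← hM, ENNReal.toReal_natCast] at h4
  push_cast at h4
  have : M + 1 ≤ d / (2 * r) := by
    rw [le_div_iff₀ (by positivity)]; linarith
  linarith

lemma conv_real {n : ℕ} {φ : Euc n → EReal} (hφ : InCvx φ) {x z : Euc n} {a c l : ℝ}
    (hz : φ z = a) (hx : φ x = c) (h0 : 0 ≤ l) (h1 : l ≤ 1) :
    ∃ b : ℝ, φ ((1 - l) • z + l • x) = b ∧ b ≤ (1 - l) * a + l * c := by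
  have := hφ.convex z x l h0 h1
  rw [hz, hx] at this
  exact real_of_le (hφ.noBot _) (by exact_mod_cast this)

lemma exists_ball {n : ℕ} {φ : Euc n → EReal} (hφ : InCvx φ) :
    ∃ (x0 : Euc n) (c s r : ℝ), φ x0 = c ∧ c + 1 ≤ s ∧ 0 < r ∧
      Metric.ball x0 r ⊆ {x | φ x ≤ (s : EReal)} := by
  have hm : Measurable φ := hφ.lsc.measurable
  have hex : ∃ N : ℕ, volume {x | φ x ≤ ((N : ℝ) : EReal)} ≠ 0 := by
    by_contra hcon
    push Not at hcon
    have h0 : volume (⋃ N : ℕ, {x | φ x ≤ ((N : ℝ) : EReal)}) = 0 := measure_iUnion_null hcon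
    have : VolE φ = 0 := by
      unfold VolE
      rw [lintegral_eq_zero_iff (by exact erealExp_measurable.comp hm.neg)]
      rw [measure_eq_zero_iff_ae_notMem] at h0
      filter_upwards [h0] with x hx
      have : φ x = ⊤ := by
        by_contra hne
        apply hx
        lift φ x to ℝ using ⟨hne, hφ.noBot x⟩ with a ha
        obtain ⟨N, hN⟩ := exists_nat_ge a
        rw [Set.mem_iUnion]
        exact ⟨N, by rw [Set.mem_ofPred_eq, ← ha]; exact_mod_cast hN⟩
      simp [this, erealExp]
    exact hφ.volPos.ne' this
  obtain ⟨N, hN⟩ := hex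
  have hconv : Convex ℝ {x | φ x ≤ ((N : ℝ) : EReal)} := by
    intro x hx y hy a b ha hb hab
    obtain ⟨u, hu, hu'⟩ := real_of_le (hφ.noBot _) hx
    obtain ⟨v, hv, hv'⟩ := real_of_le (hφ.noBot _) hy
    obtain ⟨w, hw, hw'⟩ := conv_real hφ (l := b) hu hv hb (by linarith)
    have : a = 1 - b := by linarith
    subst this
    rw [Set.mem_ofPred_eq, hw]
    have : w ≤ N := by nlinarith
    exact_mod_cast this
  have hint : (interior {x | φ x ≤ ((N : ℝ) : EReal)}).Nonempty := by
    rw [Set.nonempty_iff_ne_empty]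
    intro h
    have hf := hconv.addHaar_frontier volume
    apply hN
    refine measure_mono_null ?_ hf
    rw [frontier, h, Set.sdiff_empty]
    exact subset_closure
  obtain ⟨x0, hx0⟩ := hint
  obtain ⟨r, hr, hb⟩ := Metric.isOpen_iff.1 isOpen_interior x0 hx0
  have hsub : ∀ x ∈ interior {x | φ x ≤ ((N : ℝ) : EReal)}, φ x ≤ ((N : ℝ) : EReal) :=
    fun x hx => by simpa using! interior_subset hx
  obtain ⟨c, hc, hc'⟩ := real_of_le (hφ.noBot _) (hsub x0 hx0)
  refine ⟨x0, c, N + 1, r, hc, by linarith, hr, fun x hx => ?_⟩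
  have h1 : φ x ≤ ((N : ℝ) : EReal) := hsub x (hb hx)
  exact h1.trans (by exact_mod_cast (by linarith : (N : ℝ) ≤ N + 1))

lemma sublevel_finite {n : ℕ} {φ : Euc n → EReal} (hφ : InCvx φ) (s : ℝ) :
    volume {x | φ x ≤ (s : EReal)} < ⊤ := by
  have hm : Measurable φ := hφ.lsc.measurable
  have := meas_ge_le_lintegral_div (μ := volume)
    (erealExp_measurable.comp hm.neg).aemeasurable
    (ε := ENNReal.ofReal (Real.exp (-s))) (by simp [Real.exp_pos]) (by simp)
  refine lt_of_le_of_lt (measure_mono ?_) (lt_of_le_of_lt this ?_)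
  · intro x hx
    rw [Set.mem_ofPred_eq, ← erealExp_coe]
    apply erealExp_mono
    rw [EReal.coe_neg]
    exact EReal.neg_le_neg_iff.2 hx
  · exact ENNReal.div_lt_top hφ.volFin.ne (by simp [Real.exp_pos])

lemma growth {n : ℕ} {φ : Euc n → EReal} (hφ : InCvx φ) :
    ∃ (x0 : Euc n) (c R : ℝ), φ x0 = c ∧ 0 < R ∧
      ∀ z a, φ z = (a : ℝ) → R ≤ ‖z - x0‖ → ‖z - x0‖ ≤ R * (a - c) := by
  obtain ⟨x0, c, s, r, hc, hcs, hr, hb⟩ := exists_ball hφ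
  have hconv : Convex ℝ {x | φ x ≤ (s : EReal)} := by
    intro x hx y hy a b ha hb hab
    obtain ⟨u, hu, hu'⟩ := real_of_le (hφ.noBot _) hx
    obtain ⟨v, hv, hv'⟩ := real_of_le (hφ.noBot _) hy
    obtain ⟨w, hw, hw'⟩ := conv_real hφ (l := b) hu hv hb (by linarith)
    have : a = 1 - b := by linarith
    subst this
    rw [Set.mem_ofPred_eq, hw]
    have : w ≤ s := by nlinarith
    exact_mod_cast this
  obtain ⟨R, hR, hRb⟩ := bounded_of_finite _ hconv x0 r hr hb (sublevel_finite hφ s)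
  refine ⟨x0, c, R, hc, hR, fun z a hz hd => ?_⟩
  set d := ‖z - x0‖ with hdd
  have hdpos : 0 < d := lt_of_lt_of_le hR hd
  have hl1 : 1 - R / d ≤ 1 := by
    have : 0 < R / d := by positivity
    linarith
  have hl0 : 0 ≤ 1 - R / d := by
    have : R / d ≤ 1 := (div_le_one hdpos).2 hd
    linarith
  obtain ⟨b, hb1, hb2⟩ := conv_real hφ hz hc hl0 hl1
  have hnot : ¬ b ≤ s := by
    intro hbs
    have := hRb ((1 - (1 - R / d)) • z + (1 - R / d) • x0)
      (by rw [Set.mem_ofPred_eq, hb1]; exact_mod_cast hbs)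
    have e : (1 - (1 - R / d)) • z + (1 - R / d) • x0 - x0 = (R / d) • (z - x0) := by module
    rw [e, norm_smul, ← hdd, Real.norm_eq_abs, abs_of_pos (by positivity),
      div_mul_cancel₀ _ hdpos.ne'] at this
    exact lt_irrefl _ this
  push Not at hnot
  have h1 : 1 ≤ R / d * (a - c) := by nlinarith
  rw [div_mul_eq_mul_div, le_div_iff₀ hdpos] at h1
  linarith

lemma first_moment {n : ℕ} {φ : Euc n → EReal} (hφ : InCvx φ) :
    ∫⁻ z, ENNReal.ofReal ‖z‖ * erealExp (-(φ z)) < ⊤ := by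
  obtain ⟨x0, c, R, hc, hR, hg⟩ := growth hφ
  have hm : Measurable φ := hφ.lsc.measurable
  have hme : Measurable (fun z => erealExp (-(φ z))) := erealExp_measurable.comp hm.neg
  have key : ∀ z, ENNReal.ofReal ‖z‖ * erealExp (-(φ z)) ≤
      ENNReal.ofReal (‖x0‖ + R) * erealExp (-(φ z)) +
      ENNReal.ofReal (2 * R) * erealExp (-(φ ((1/2 : ℝ) • z + (1/2 : ℝ) • x0))) := by
    intro z
    by_cases htop : φ z = ⊤
    · simp [htop, erealExp]
    obtain ⟨a, ha⟩ : ∃ a : ℝ, φ z = a := by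
      lift φ z to ℝ using ⟨htop, hφ.noBot z⟩ with a ha
      exact ⟨a, rfl⟩
    obtain ⟨b, hb, hb'⟩ := conv_real hφ (l := 1/2) ha hc (by norm_num) (by norm_num)
    rw [show (1 - 1/2 : ℝ) = 1/2 by norm_num] at hb hb'
    rw [ha, hb, ← EReal.coe_neg, ← EReal.coe_neg, erealExp_coe, erealExp_coe,
      ← ENNReal.ofReal_mul (by positivity), ← ENNReal.ofReal_mul (by positivity),
      ← ENNReal.ofReal_mul (by positivity), ← ENNReal.ofReal_add (by positivity) (by positivity)]
    apply ENNReal.ofReal_le_ofReal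
    have hn : ‖z‖ ≤ ‖z - x0‖ + ‖x0‖ := by
      simpa using norm_add_le (z - x0) x0
    have hea := Real.exp_pos (-a)
    have heb := Real.exp_pos (-b)
    rcases le_or_gt R ‖z - x0‖ with h | h
    · have h1 := hg z a ha h
      have h2 : (a - c) / 2 ≤ Real.exp ((a - c) / 2) := by
        linarith [Real.add_one_le_exp ((a - c) / 2)]
      have h3 : Real.exp ((a - c) / 2) * Real.exp (-a) ≤ Real.exp (-b) := by
        rw [← Real.exp_add]; apply Real.exp_le_exp.2; linarith
      have h4 : ‖z - x0‖ ≤ 2 * R * Real.exp ((a - c) / 2) := by nlinarith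
      calc ‖z‖ * Real.exp (-a) ≤ (‖x0‖ + 2 * R * Real.exp ((a - c) / 2)) * Real.exp (-a) := by
            gcongr; linarith
        _ = ‖x0‖ * Real.exp (-a) + 2 * R * (Real.exp ((a - c) / 2) * Real.exp (-a)) := by ring
        _ ≤ (‖x0‖ + R) * Real.exp (-a) + 2 * R * Real.exp (-b) := by
            gcongr; linarith
    · have : ‖z‖ * Real.exp (-a) ≤ (‖x0‖ + R) * Real.exp (-a) := by
        gcongr; linarith
      have : 0 < 2 * R * Real.exp (-b) := by positivity
      linarith
  refine lt_of_le_of_lt (lintegral_mono key) ?_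
  rw [lintegral_add_left (hme.const_mul _), lintegral_const_mul _ hme,
    lintegral_const_mul _ (by exact hme.comp (by fun_prop)),
    lintegral_affine (fun z => erealExp (-(φ z))) hme _ (by norm_num)]
  have hv : ∫⁻ z, erealExp (-(φ z)) < ⊤ := hφ.volFin
  exact ENNReal.add_lt_top.2 ⟨ENNReal.mul_lt_top ENNReal.ofReal_lt_top hv,
    ENNReal.mul_lt_top ENNReal.ofReal_lt_top (ENNReal.mul_lt_top ENNReal.ofReal_lt_top hv)⟩

lemma vol_le_exp {n : ℕ} {φ : Euc n → EReal} (hφ : InCvx φ) (hbary : bary φ = 0) (y : Euc n) :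
    VolE φ ≤ ∫⁻ z, ENNReal.ofReal (Real.exp ⟪z, y⟫) * erealExp (-(φ z)) := by
  have hm : Measurable φ := hφ.lsc.measurable
  have hme : Measurable (fun z => erealExp (-(φ z))) := erealExp_measurable.comp hm.neg
  have hne : ∀ z, erealExp (-(φ z)) ≠ ⊤ := by
    intro z
    rw [erealExp_eq]
    simpa using hφ.noBot z
  set f : Euc n → ℝ := fun z => (erealExp (-(φ z))).toReal with hf
  have hfe : ∀ z, erealExp (-(φ z)) = ENNReal.ofReal (f z) := fun z =>
    (ENNReal.ofReal_toReal (hne z)).symm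
  have hf0 : ∀ z, 0 ≤ f z := fun z => ENNReal.toReal_nonneg
  have hfm : Measurable f := hme.ennreal_toReal
  have hfi : Integrable f := integrable_toReal_of_lintegral_ne_top hme.aemeasurable hφ.volFin.ne
  have hfz : Integrable (fun z => f z • z) := by
    refine ⟨by fun_prop, ?_⟩
    refine lt_of_le_of_lt (lintegral_mono fun z => ?_) (first_moment hφ)
    rw [enorm_smul, hfe, mul_comm, ← ofReal_norm, ← ofReal_norm, Real.norm_of_nonneg (hf0 z)]
  have hV0 : Vol φ ≠ 0 := (ENNReal.toReal_pos hφ.volPos.ne' hφ.volFin.ne).ne'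
  have hz : ∫ z, f z • z = 0 := by
    have := hbary
    unfold bary at this
    rcases smul_eq_zero.1 this with h | h
    · exact absurd (inv_eq_zero.1 h) hV0
    · exact h
  have hVf : ∫ z, f z = Vol φ := integral_toReal hme.aemeasurable
    (ae_of_all _ fun z => lt_top_iff_ne_top.2 (hne z))
  have hin : ∫ z, ⟪y, f z • z⟫ = 0 := by
    rw [integral_inner hfz, hz, inner_zero_right]
  have hini : Integrable (fun z => ⟪y, f z • z⟫) := hfz.const_inner y
  have htot : ∫ z, (f z + ⟪y, f z • z⟫) = Vol φ := by
    rw [integral_add hfi hini, hin, hVf, add_zero]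
  by_cases htop : ∫⁻ z, ENNReal.ofReal (Real.exp ⟪z, y⟫) * erealExp (-(φ z)) = ⊤
  · rw [htop]; exact le_top
  have heq : ∀ z, ENNReal.ofReal (Real.exp ⟪z, y⟫) * erealExp (-(φ z))
      = ENNReal.ofReal (Real.exp ⟪z, y⟫ * f z) := fun z => by
    rw [hfe, ENNReal.ofReal_mul (Real.exp_pos _).le]
  simp_rw [heq] at htop ⊢
  have hgm : Measurable (fun z : Euc n => Real.exp ⟪z, y⟫ * f z) := by fun_prop
  have hgi : Integrable (fun z : Euc n => Real.exp ⟪z, y⟫ * f z) :=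
    (lintegral_ofReal_ne_top_iff_integrable hgm.aestronglyMeasurable
      (ae_of_all _ fun z => mul_nonneg (Real.exp_pos _).le (hf0 z))).1 htop
  rw [← ofReal_integral_eq_lintegral_ofReal hgi
    (ae_of_all _ fun z => mul_nonneg (Real.exp_pos _).le (hf0 z))]
  rw [← ENNReal.ofReal_toReal hφ.volFin.ne]
  apply ENNReal.ofReal_le_ofReal
  change Vol φ ≤ _
  rw [← htot]
  apply integral_mono (hfi.add hini) hgi
  intro z
  change f z + ⟪y, f z • z⟫ ≤ Real.exp ⟪z, y⟫ * f z
  rw [inner_smul_right, real_inner_comm]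
  nlinarith [mul_le_mul_of_nonneg_right (Real.add_one_le_exp ⟪z, y⟫) (hf0 z)]

lemma core {n : ℕ} {p : ℝ} (hp : 0 < p) {φ : Euc n → EReal} (hφ : InCvx φ)
    (hbary : bary φ = 0) (y x0 : Euc n) (c : ℝ) (hc : φ x0 = c) :
    ENNReal.ofReal (Real.exp (p * (⟪x0, y⟫ - c))) * VolE φ ≤
      ENNReal.ofReal ((1 + p) ^ n) * LpIntE p φ (((1 + p) / p) • y) := by
  have hm : Measurable φ := hφ.lsc.measurable
  have hme : Measurable (fun z => erealExp (-(φ z))) := erealExp_measurable.comp hm.neg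
  set G : Euc n → ℝ≥0∞ := fun x => erealExp (((p * ⟪x, ((1 + p) / p) • y⟫ : ℝ) : EReal)
    - ((p + 1 : ℝ) : EReal) * φ x) with hG
  have hGm : Measurable G := by
    apply erealExp_measurable.comp
    have h1 : Measurable (fun x : Euc n => ((p * ⟪x, ((1 + p) / p) • y⟫ : ℝ) : EReal)) :=
      measurable_coe_real_ereal.comp (by fun_prop)
    exact h1.sub (hm.const_mul _)
  have h1p : (0 : ℝ) < 1 + p := by linarith
  have hs : (0 : ℝ) < 1 - p / (1 + p) := by
    rw [sub_pos, div_lt_one h1p]; linarith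
  have hse : 1 - p / (1 + p) = (1 + p)⁻¹ := by field_simp; ring
  have haff := lintegral_affine G hGm (1 - p / (1 + p)) hs ((p / (1 + p)) • x0)
  have key : ∀ z, ENNReal.ofReal (Real.exp (p * (⟪x0, y⟫ - c))) *
      (ENNReal.ofReal (Real.exp ⟪z, y⟫) * erealExp (-(φ z))) ≤
      G ((1 - p / (1 + p)) • z + (p / (1 + p)) • x0) := by
    intro z
    by_cases htop : φ z = ⊤
    · simp [htop, erealExp]
    obtain ⟨a, ha⟩ : ∃ a : ℝ, φ z = a := by
      lift φ z to ℝ using ⟨htop, hφ.noBot z⟩ with a ha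
      exact ⟨a, rfl⟩
    obtain ⟨b, hb, hb'⟩ := conv_real hφ (l := p / (1 + p)) ha hc (by positivity) (by linarith)
    simp only [hG]
    rw [ha, hb, ← EReal.coe_neg, erealExp_coe, ← EReal.coe_mul, ← EReal.coe_sub, erealExp_coe,
      ← ENNReal.ofReal_mul (by positivity), ← ENNReal.ofReal_mul (by positivity),
      ← Real.exp_add, ← Real.exp_add]
    apply ENNReal.ofReal_le_ofReal
    apply Real.exp_le_exp.2
    have e : p * ⟪(1 - p / (1 + p)) • z + (p / (1 + p)) • x0, ((1 + p) / p) • y⟫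
        = ⟪z, y⟫ + p * ⟪x0, y⟫ := by
      rw [inner_smul_right, inner_add_left, real_inner_smul_left, real_inner_smul_left]
      field_simp
      ring
    rw [e]
    have h2 : (p + 1) * b ≤ a + p * c := by
      calc (p + 1) * b ≤ (p + 1) * ((1 - p / (1 + p)) * a + p / (1 + p) * c) := by gcongr
        _ = a + p * c := by field_simp; ring
    linarith
  calc ENNReal.ofReal (Real.exp (p * (⟪x0, y⟫ - c))) * VolE φ
      ≤ ENNReal.ofReal (Real.exp (p * (⟪x0, y⟫ - c))) *
        ∫⁻ z, ENNReal.ofReal (Real.exp ⟪z, y⟫) * erealExp (-(φ z)) := by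
        gcongr; exact vol_le_exp hφ hbary y
    _ = ∫⁻ z, ENNReal.ofReal (Real.exp (p * (⟪x0, y⟫ - c))) *
        (ENNReal.ofReal (Real.exp ⟪z, y⟫) * erealExp (-(φ z))) := by
        rw [lintegral_const_mul]
        exact Measurable.mul (by fun_prop) hme
    _ ≤ _ := lintegral_mono key
    _ = _ := by
        rw [haff, hse, inv_pow, inv_inv]
        rfl

lemma lpInt_pos {n : ℕ} {p : ℝ} (hp : 0 < p) {φ : Euc n → EReal} (hφ : InCvx φ) (y : Euc n) :
    LpIntE p φ y ≠ 0 := by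
  intro h
  have hm : Measurable φ := hφ.lsc.measurable
  have h1 : Measurable (fun x : Euc n => ((p * ⟪x, y⟫ : ℝ) : EReal)) :=
    measurable_coe_real_ereal.comp (by fun_prop)
  unfold LpIntE at h
  rw [lintegral_eq_zero_iff (by exact erealExp_measurable.comp (h1.sub (hm.const_mul _)))] at h
  apply hφ.volPos.ne'
  unfold VolE
  rw [lintegral_eq_zero_iff (by exact erealExp_measurable.comp hm.neg)]
  filter_upwards [h] with x hx
  by_cases htop : φ x = ⊤
  · simp [htop, erealExp]
  lift φ x to ℝ using ⟨htop, hφ.noBot x⟩ with a ha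
  rw [← EReal.coe_mul, ← EReal.coe_sub, erealExp_coe] at hx
  exact absurd hx (by simp [Real.exp_pos])

lemma lstar_le {n : ℕ} {p : ℝ} (hp : 0 < p) {φ : Euc n → EReal} (hφ : InCvx φ)
    (hbary : bary φ = 0) (y : Euc n) :
    Lstar φ y ≤
      LpStar p φ (((1 + p) / p) • y) + (((n : ℝ) / p * Real.log (1 + p) : ℝ) : EReal) := by
  unfold LpStar
  split_ifs with htop
  · rw [EReal.top_add_coe]; exact le_top
  refine iSup_le fun x => ?_
  by_cases hx : φ x = ⊤
  · simp [hx]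
  obtain ⟨c, hc⟩ : ∃ c : ℝ, φ x = c := by
    lift φ x to ℝ using ⟨hx, hφ.noBot x⟩ with a ha
    exact ⟨a, rfl⟩
  have h := core hp hφ hbary y x c hc
  have h2 := ENNReal.toReal_mono (ENNReal.mul_ne_top ENNReal.ofReal_ne_top htop) h
  rw [ENNReal.toReal_mul, ENNReal.toReal_mul, ENNReal.toReal_ofReal (by positivity),
    ENNReal.toReal_ofReal (by positivity)] at h2
  have hV : 0 < Vol φ := ENNReal.toReal_pos hφ.volPos.ne' hφ.volFin.ne
  have hI := ENNReal.toReal_pos (lpInt_pos hp hφ (((1 + p) / p) • y)) htop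
  set I := (LpIntE p φ (((1 + p) / p) • y)).toReal
  change _ * Vol φ ≤ _ at h2
  rw [hc, ← EReal.coe_sub, ← EReal.coe_add, EReal.coe_le_coe_iff]
  rw [← le_div_iff₀ hV, mul_div_assoc] at h2
  have h3 := Real.log_le_log (Real.exp_pos _) h2
  rw [Real.log_exp, Real.log_mul (by positivity) (by positivity), Real.log_pow] at h3
  have e : 1 / p * Real.log (I / Vol φ) + (n : ℝ) / p * Real.log (1 + p)
    = (n * Real.log (1 + p) + Real.log (I / Vol φ)) / p := by ring
  rw [e, le_div_iff₀ hp]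
  linarith

lemma lpStar_le_lstar {n : ℕ} {q : ℝ} (hq : 0 < q) {φ : Euc n → EReal} (hφ : InCvx φ)
    (y : Euc n) : LpStar q φ y ≤ Lstar φ y := by
  by_cases hL : Lstar φ y = ⊤
  · rw [hL]; exact le_top
  obtain ⟨x1, hx1⟩ := hφ.proper
  have hbot : Lstar φ y ≠ ⊥ := by
    have h : (((⟪x1, y⟫ : ℝ) : EReal) - φ x1) ≤ Lstar φ y :=
      le_iSup (fun x : Euc n => (((⟪x, y⟫ : ℝ) : EReal) - φ x)) x1
    intro hb
    rw [hb, le_bot_iff] at h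
    lift φ x1 to ℝ using ⟨hx1, hφ.noBot x1⟩ with a ha
    rw [← EReal.coe_sub] at h
    exact EReal.coe_ne_bot _ h
  obtain ⟨L, hLe⟩ : ∃ L : ℝ, Lstar φ y = L := by
    lift Lstar φ y to ℝ using ⟨hL, hbot⟩ with L
    exact ⟨L, rfl⟩
  have hm : Measurable φ := hφ.lsc.measurable
  have hme : Measurable (fun z => erealExp (-(φ z))) := erealExp_measurable.comp hm.neg
  have hle : LpIntE q φ y ≤ ENNReal.ofReal (Real.exp (q * L)) * VolE φ := by
    unfold LpIntE VolE
    rw [← lintegral_const_mul _ hme]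
    refine lintegral_mono fun x => ?_
    by_cases htop : φ x = ⊤
    · have : ((q + 1 : ℝ) : EReal) * ⊤ = ⊤ := EReal.coe_mul_top_of_pos (by linarith)
      simp only [htop, this]
      simp [erealExp]
    have h : (((⟪x, y⟫ : ℝ) : EReal) - φ x) ≤ Lstar φ y :=
      le_iSup (fun x : Euc n => (((⟪x, y⟫ : ℝ) : EReal) - φ x)) x
    rw [hLe] at h
    obtain ⟨a, ha⟩ : ∃ a : ℝ, φ x = a := by
      lift φ x to ℝ using ⟨htop, hφ.noBot x⟩ with a ha
      exact ⟨a, rfl⟩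
    rw [ha, ← EReal.coe_sub, EReal.coe_le_coe_iff] at h
    simp only [ha]
    rw [← EReal.coe_neg, erealExp_coe, ← EReal.coe_mul, ← EReal.coe_sub, erealExp_coe,
      ← ENNReal.ofReal_mul (by positivity), ← Real.exp_add]
    apply ENNReal.ofReal_le_ofReal
    apply Real.exp_le_exp.2
    nlinarith
  have hrt : ENNReal.ofReal (Real.exp (q * L)) * VolE φ ≠ ⊤ :=
    ENNReal.mul_ne_top ENNReal.ofReal_ne_top hφ.volFin.ne
  have htop : LpIntE q φ y ≠ ⊤ := ne_top_of_le_ne_top hrt hle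
  have h2 := ENNReal.toReal_mono hrt hle
  rw [ENNReal.toReal_mul, ENNReal.toReal_ofReal (by positivity)] at h2
  have hV : 0 < Vol φ := ENNReal.toReal_pos hφ.volPos.ne' hφ.volFin.ne
  have hI := ENNReal.toReal_pos (lpInt_pos hq hφ y) htop
  unfold LpStar
  rw [if_neg htop, hLe, EReal.coe_le_coe_iff]
  change _ ≤ _ * Vol φ at h2
  rw [← div_le_iff₀ hV] at h2
  have h3 := Real.log_le_log (by positivity) h2
  rw [Real.log_exp] at h3
  rw [one_div, inv_mul_le_iff₀ hq]
  exact h3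

/-- reverse inequality at the barycenter.
For `p ∈ (0,∞)` and `φ ∈ Cvx(ℝⁿ)` with `b(φ) = 0`,
`φ^*(y) ≤ φ^{*,p}(((1+p)/p) y) + (n/p) log(1+p)`; the same bound holds with `φ^*`
replaced by `φ^{*,q}` for any `q ∈ (p,∞)`. -/
theorem lp_legendre_reverse (n : ℕ) (p : ℝ) (hp : 0 < p)
    (φ : Euc n → EReal) (hφ : InCvx φ) (hbary : bary φ = 0) (y : Euc n) :
    Lstar φ y ≤
      LpStar p φ (((1 + p) / p) • y) + (((n : ℝ) / p * Real.log (1 + p) : ℝ) : EReal) ∧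
    ∀ q : ℝ, p < q →
      LpStar q φ y ≤
        LpStar p φ (((1 + p) / p) • y) + (((n : ℝ) / p * Real.log (1 + p) : ℝ) : EReal) := by
  have h := lstar_le hp hφ hbary y
  exact ⟨h, fun q hq => (lpStar_le_lstar (hp.trans hq) hφ y).trans h⟩

end
end

section
/- Let p ∈ (0,∞) and n ≥ 1. The L^p-Mahler integral of the ℓ¹-norm φ₁(x) := |x₁| + … + |xₙ| on ℝⁿ equals M_p(φ₁) = ( ((p+1)^{1+1/p}/p) · 2√π · Γ(1 + 1/p) / Γ(3/2 + 1/p) )ⁿ, where Γ is the Gamma function. -/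
open MeasureTheory Real Filter
open scoped ENNReal RealInnerProductSpace Classical

noncomputable section

lemma lm_lintegral_prod (n : ℕ) (f : Fin n → ℝ → ℝ≥0∞) (hf : ∀ i, Measurable (f i)) :
    ∫⁻ x : Fin n → ℝ, ∏ i, f i (x i) = ∏ i, ∫⁻ t, f i t := by
  induction n with
  | zero => simp [volume_pi]
  | succ n ih =>
    have h := (volume_preserving_piFinSuccAbove (fun _ : Fin (n+1) => ℝ) 0).symm.lintegral_map_equiv
      (fun x : Fin (n+1) → ℝ => ∏ i, f i (x i))
    rw [h]
    simp only [Fin.prod_univ_succ]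
    rw [← ih (fun i => f i.succ) (fun i => hf _), ← lintegral_prod_mul]
    · rfl
    · exact (hf 0).aemeasurable
    · apply Measurable.aemeasurable
      exact Finset.measurable_prod _ (fun i _ => (hf i.succ).comp (measurable_pi_apply i))

lemma lm_lintegral_euc (n : ℕ) (f : Fin n → ℝ → ℝ≥0∞) (hf : ∀ i, Measurable (f i)) :
    ∫⁻ x : Euc n, ∏ i, f i (x i) = ∏ i, ∫⁻ t, f i t := by
  rw [← lm_lintegral_prod n f hf]
  exact (EuclideanSpace.volume_preserving_symm_measurableEquiv_toLp (Fin n)).lintegral_comp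
    (f := fun x : Fin n → ℝ => ∏ i, f i (x i))
    (Finset.measurable_prod _ (fun i _ => (hf i).comp (measurable_pi_apply i)))

lemma lm_erealExp_coe (t : ℝ) : erealExp (t : EReal) = ENNReal.ofReal (Real.exp t) := by
  simp [erealExp]

lemma lm_half (a : ℝ) (ha : 0 < a) :
    ∫⁻ x in Set.Ioi (0:ℝ), ENNReal.ofReal (Real.exp (-a * x)) = ENNReal.ofReal (1 / a) := by
  rw [← ofReal_integral_eq_lintegral_ofReal]
  · rw [integral_exp_mul_Ioi (by linarith)]
    simp [neg_div_neg_eq]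
  · exact integrableOn_exp_mul_Ioi (by linarith) 0
  · exact Eventually.of_forall fun x => (Real.exp_pos _).le

lemma lm_half_top (a : ℝ) (ha : a ≤ 0) :
    ∫⁻ x in Set.Ioi (0:ℝ), ENNReal.ofReal (Real.exp (-a * x)) = ⊤ := by
  rw [eq_top_iff]
  calc (⊤ : ℝ≥0∞) = ∫⁻ x in Set.Ioi (0:ℝ), 1 := by simp
    _ ≤ _ := by
      apply setLIntegral_mono' measurableSet_Ioi
      intro x hx
      rw [← ENNReal.ofReal_one]
      apply ENNReal.ofReal_le_ofReal
      apply Real.one_le_exp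
      have : (0:ℝ) < x := hx
      nlinarith

lemma lm_split (b c : ℝ) :
    ∫⁻ x : ℝ, ENNReal.ofReal (Real.exp (b * x - c * |x|)) =
      (∫⁻ x in Set.Ioi (0:ℝ), ENNReal.ofReal (Real.exp (-(c + b) * x))) +
      ∫⁻ x in Set.Ioi (0:ℝ), ENNReal.ofReal (Real.exp (-(c - b) * x)) := by
  rw [← lintegral_add_compl _ (measurableSet_Iic (a := (0:ℝ))), Set.compl_Iic]
  congr 1
  · have h := lintegral_image_eq_lintegral_abs_deriv_mul (s := Set.Ioi (0:ℝ)) (f := fun x : ℝ => -x)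
      (f' := fun _ => -1) measurableSet_Ioi
      (fun x _ => (hasDerivAt_neg x).hasDerivWithinAt) neg_injective.injOn
      (fun x : ℝ => ENNReal.ofReal (Real.exp (b * x - c * |x|)))
    rw [setLIntegral_congr (Iio_ae_eq_Iic (a := (0:ℝ))).symm]
    have e : (fun x : ℝ => -x) '' Set.Ioi 0 = Set.Iio 0 := by simp
    rw [e] at h
    rw [h]
    apply setLIntegral_congr_fun measurableSet_Ioi
    intro x hx
    have hx' : (0:ℝ) < x := hx
    simp only [abs_neg, abs_one, ENNReal.ofReal_one, one_mul, abs_of_pos hx']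
    congr 2; ring
  · apply setLIntegral_congr_fun measurableSet_Ioi
    intro x hx
    have hx' : (0:ℝ) < x := hx
    simp only [abs_of_pos hx']
    congr 2; ring

lemma lm_J (b c : ℝ) (h : |b| < c) :
    ∫⁻ x : ℝ, ENNReal.ofReal (Real.exp (b * x - c * |x|)) =
      ENNReal.ofReal (2 * c / (c ^ 2 - b ^ 2)) := by
  obtain ⟨h1, h2⟩ := abs_lt.1 h
  have k1 : 0 < c + b := by linarith
  have k2 : 0 < c - b := by linarith
  rw [lm_split, lm_half _ k1, lm_half _ k2, ← ENNReal.ofReal_add (by positivity) (by positivity)]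
  congr 1
  rw [show c ^ 2 - b ^ 2 = (c + b) * (c - b) by ring]
  field_simp
  ring

lemma lm_J_top (b c : ℝ) (h : ¬ |b| < c) :
    ∫⁻ x : ℝ, ENNReal.ofReal (Real.exp (b * x - c * |x|)) = ⊤ := by
  rw [lm_split]
  rcases le_abs.1 (not_lt.1 h) with h | h
  · rw [lm_half_top (c - b) (by linarith)]; simp
  · rw [lm_half_top (c + b) (by linarith)]; simp

lemma lm_J_pos (b c : ℝ) :
    ∫⁻ x : ℝ, ENNReal.ofReal (Real.exp (b * x - c * |x|)) ≠ 0 := by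
  by_cases h : |b| < c
  · rw [lm_J b c h]
    have : 0 < c := lt_of_le_of_lt (abs_nonneg _) h
    have : 0 < c ^ 2 - b ^ 2 := by
      have := sq_lt_sq' (by linarith [(abs_lt.1 h).1]) (abs_lt.1 h).2
      linarith
    have : 0 < 2 * c / (c ^ 2 - b ^ 2) := by positivity
    simpa using this
  · rw [lm_J_top b c h]; simp

lemma lm_meas (b c : ℝ) : Measurable fun x : ℝ => ENNReal.ofReal (Real.exp (b * x - c * |x|)) := by
  fun_prop

lemma lm_VolE (n : ℕ) : VolE (fun x : Euc n => ((∑ i, |x i| : ℝ) : EReal)) = 2 ^ n := by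
  unfold VolE
  have : ∀ x : Euc n, erealExp (-((∑ i, |x i| : ℝ) : EReal)) =
      ∏ i, (fun (_ : Fin n) (t : ℝ) => ENNReal.ofReal (Real.exp (0 * t - 1 * |t|))) i (x i) := by
    intro x
    rw [← EReal.coe_neg, lm_erealExp_coe, ← Finset.sum_neg_distrib, Real.exp_sum,
      ENNReal.ofReal_prod_of_nonneg (fun i _ => (Real.exp_pos _).le)]
    simp
  simp_rw [this]
  rw [lm_lintegral_euc n _ (fun _ => lm_meas 0 1)]
  rw [lm_J 0 1 (by simp)]
  simp

lemma lm_LpIntE (n : ℕ) (p : ℝ) (y : Euc n) :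
    LpIntE p (fun x : Euc n => ((∑ i, |x i| : ℝ) : EReal)) y =
      ∏ i, ∫⁻ x : ℝ, ENNReal.ofReal (Real.exp ((p * y i) * x - (p + 1) * |x|)) := by
  unfold LpIntE
  rw [← lm_lintegral_euc n _ (fun i => lm_meas (p * y i) (p + 1))]
  apply lintegral_congr
  intro x
  rw [← EReal.coe_mul, ← EReal.coe_sub, lm_erealExp_coe,
    ← ENNReal.ofReal_prod_of_nonneg (fun i _ => (Real.exp_pos _).le), ← Real.exp_sum]
  congr 2
  rw [Finset.sum_sub_distrib, Finset.mul_sum, PiLp.inner_apply, Finset.mul_sum]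
  congr 1
  apply Finset.sum_congr rfl
  intro i _
  simp
  ring

/-- The one-dimensional density of the polar function. -/
def lmG (p t : ℝ) : ℝ≥0∞ :=
  if |p * t| < p + 1 then
    ENNReal.ofReal ((((p + 1) ^ 2 - (p * t) ^ 2) / (p + 1)) ^ (1 / p)) else 0

lemma lmG_meas (p : ℝ) : Measurable (lmG p) := by
  unfold lmG
  apply Measurable.ite
  · exact measurableSet_lt (by fun_prop) (by fun_prop)
  · fun_prop
  · fun_prop

lemma lm_star (n : ℕ) (p : ℝ) (hp : 0 < p) (y : Euc n) :
    erealExp (-(LpStar p (fun x : Euc n => ((∑ i, |x i| : ℝ) : EReal)) y)) = ∏ i, lmG p (y i) := by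
  unfold LpStar Vol
  rw [lm_LpIntE, lm_VolE]
  by_cases h : ∀ i, |p * y i| < p + 1
  · have hq : ∀ i, 0 < (p + 1) ^ 2 - (p * y i) ^ 2 := fun i => by
      have := sq_lt_sq' (by linarith [(abs_lt.1 (h i)).1]) (abs_lt.1 (h i)).2
      linarith
    have e : ∏ i, ∫⁻ x : ℝ, ENNReal.ofReal (Real.exp ((p * y i) * x - (p + 1) * |x|)) =
        ENNReal.ofReal (∏ i, (2 * (p + 1) / ((p + 1) ^ 2 - (p * y i) ^ 2))) := by
      rw [ENNReal.ofReal_prod_of_nonneg]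
      · exact Finset.prod_congr rfl fun i _ => lm_J _ _ (h i)
      · intro i _
        have := hq i
        positivity
    rw [e, if_neg ENNReal.ofReal_ne_top, ← EReal.coe_neg, lm_erealExp_coe]
    have e2 : ∀ i, lmG p (y i) =
      ENNReal.ofReal ((((p + 1) ^ 2 - (p * y i) ^ 2) / (p + 1)) ^ (1 / p)) := fun i => by
      rw [lmG, if_pos (h i)]
    have hr : ∀ i, 0 < ((p + 1) ^ 2 - (p * y i) ^ 2) / (p + 1) := fun i => by
      have := hq i
      positivity
    simp_rw [e2]
    rw [← ENNReal.ofReal_prod_of_nonneg (fun i _ => Real.rpow_nonneg (hr i).le _)]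
    rw [ENNReal.toReal_ofReal (Finset.prod_nonneg fun i _ => by have := hq i; positivity)]
    congr 1
    rw [Real.finsetProd_rpow _ _ (fun i _ => (hr i).le)]
    rw [Real.rpow_def_of_pos (Finset.prod_pos fun i _ => hr i)]
    congr 1
    have e3 : (∏ i, (2 * (p + 1) / ((p + 1) ^ 2 - (p * y i) ^ 2))) / ((2 : ℝ≥0∞) ^ n).toReal =
        (∏ i, (((p + 1) ^ 2 - (p * y i) ^ 2) / (p + 1)))⁻¹ := by
      have : ((2 : ℝ≥0∞) ^ n).toReal = ∏ i : Fin n, (2:ℝ) := by simp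
      rw [this, ← Finset.prod_div_distrib, ← Finset.prod_inv_distrib]
      apply Finset.prod_congr rfl
      intro i _
      have := (hq i).ne'
      field_simp
    rw [e3, Real.log_inv]
    ring
  · obtain ⟨i, hi⟩ := not_forall.1 h
    rw [if_pos]
    · rw [Finset.prod_eq_zero (Finset.mem_univ i) (by rw [lmG, if_neg hi])]
      simp [erealExp]
    · rw [← Finset.mul_prod_erase _ _ (Finset.mem_univ i), lm_J_top _ _ hi]
      exact ENNReal.top_mul (Finset.prod_ne_zero_iff.2 fun j _ => lm_J_pos _ _)

lemma lm_G_int (p : ℝ) (hp : 0 < p) : ∫⁻ t, lmG p t =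
    ENNReal.ofReal ((p + 1) ^ (1 + 1 / p) / p *
          (Real.sqrt π * Real.Gamma (1 + 1 / p) / Real.Gamma (3 / 2 + 1 / p))) := by
  have hc : 0 < (p + 1) / p := by positivity
  have hs : 0 < 1 / p := by positivity
  have hs1 : 0 < 1 / p + 1 := by positivity
  have hB := ProbabilityTheory.beta_pos hs1 hs1
  set B := ProbabilityTheory.beta (1 / p + 1) (1 / p + 1) with hBdef
  have h := lintegral_image_eq_lintegral_abs_deriv_mul (s := Set.univ)
      (f := fun u : ℝ => ((p + 1) / p) * (2 * u - 1))
      (f' := fun _ => ((p + 1) / p) * (2 * 1)) MeasurableSet.univ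
      (fun x _ => ((((hasDerivAt_id x).const_mul 2).sub_const 1).const_mul _).hasDerivWithinAt)
      (by
        intro a _ b _ hab
        have := mul_left_cancel₀ hc.ne' hab
        linarith) (lmG p)
  have e : (fun u : ℝ => ((p + 1) / p) * (2 * u - 1)) '' Set.univ = Set.univ := by
    rw [Set.image_univ]
    apply Set.range_eq_univ.2
    intro t
    refine ⟨(t / ((p + 1) / p) + 1) / 2, ?_⟩
    field_simp
    ring
  rw [e, Measure.restrict_univ] at h
  rw [h]
  have e2 : ∀ u : ℝ, ENNReal.ofReal |((p + 1) / p) * (2 * 1)| * lmG p (((p + 1) / p) * (2 * u - 1))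
      = ENNReal.ofReal (((p + 1) / p) * 2 * ((4 * (p + 1)) ^ (1 / p) * B)) *
        ProbabilityTheory.betaPDF (1 / p + 1) (1 / p + 1) u := by
    intro u
    have ht : p * (((p + 1) / p) * (2 * u - 1)) = (p + 1) * (2 * u - 1) := by
      field_simp
    unfold lmG
    rw [ht]
    by_cases hu : 0 < u ∧ u < 1
    · rw [if_pos, ProbabilityTheory.betaPDF_of_pos_lt_one hu.1 hu.2,
        ← ENNReal.ofReal_mul (abs_nonneg _), ← ENNReal.ofReal_mul (by positivity)]
      · congr 1
        rw [abs_of_pos (by positivity), ← hBdef]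
        have : ((p + 1) ^ 2 - ((p + 1) * (2 * u - 1)) ^ 2) / (p + 1) =
          (4 * (p + 1)) * (u * (1 - u)) := by
          field_simp
          ring
        have h1u : 0 < 1 - u := by linarith [hu.2]
        have h0u := hu.1
        rw [this, Real.mul_rpow (by positivity) (by positivity),
          Real.mul_rpow h0u.le h1u.le, add_sub_cancel_right]
        field_simp
      · rw [abs_mul, abs_of_pos (by linarith : 0 < p + 1)]
        have : |2 * u - 1| < 1 := abs_lt.2 ⟨by linarith [hu.1], by linarith [hu.2]⟩
        nlinarith
    · rw [if_neg, ProbabilityTheory.betaPDF_eq, if_neg hu]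
      · simp
      · intro hh
        rw [abs_mul, abs_of_pos (by linarith : 0 < p + 1)] at hh
        have : |2 * u - 1| < 1 := by
          by_contra h3
          nlinarith
        have := abs_lt.1 this
        exact hu ⟨by linarith, by linarith⟩
  simp_rw [e2]
  rw [lintegral_const_mul' _ _ ENNReal.ofReal_ne_top,
    ProbabilityTheory.lintegral_betaPDF_eq_one hs1 hs1, mul_one]
  congr 1
  have hd := Real.Gamma_mul_Gamma_add_half (1 / p + 1)
  rw [hBdef]
  unfold ProbabilityTheory.beta
  have a1 : 1 / p + 1 + 1 / 2 = 3 / 2 + 1 / p := by ring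
  have a2 : 2 * (1 / p + 1) = 1 / p + 1 + (1 / p + 1) := by ring
  have a3 : (2:ℝ) ^ (1 - (1 / p + 1 + (1 / p + 1))) = (2 * 4 ^ (1 / p))⁻¹ := by
    rw [show (4:ℝ) = 2 ^ (2:ℝ) by norm_num, ← Real.rpow_mul (by norm_num),
      show 1 - (1 / p + 1 + (1 / p + 1)) = -(1 + 2 * (1 / p)) by ring,
      Real.rpow_neg (by norm_num), Real.rpow_add (by norm_num), Real.rpow_one]
  rw [a1, a2, a3] at hd
  have g1 := Real.Gamma_pos_of_pos hs1
  have g2 := Real.Gamma_pos_of_pos (by positivity : 0 < 1 / p + 1 + (1 / p + 1))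
  have g3 := Real.Gamma_pos_of_pos (by positivity : 0 < 3 / 2 + 1 / p)
  rw [Real.mul_rpow (by norm_num) (by positivity), add_comm 1 (1 / p),
    Real.rpow_add (by positivity : 0 < p + 1), Real.rpow_one]
  generalize Real.Gamma (1 / p + 1) = G1 at *
  generalize Real.Gamma (1 / p + 1 + (1 / p + 1)) = G2 at *
  generalize Real.Gamma (3 / 2 + 1 / p) = G3 at *
  have h4 : (0:ℝ) < 4 ^ (1 / p) := by positivity
  generalize (4:ℝ) ^ (1 / p) = F at *
  generalize (p + 1) ^ (1 / p) = Q at *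
  have hd2 : 2 * F * (G1 * G3) = G2 * √π := by
    rw [hd]; field_simp
  field_simp
  linear_combination Q * hd2

/-- the `L^p`-Mahler integral of the `ℓ¹`-norm:
`M_p(‖·‖₁) = (((p+1)^{1+1/p}/p) · 2√π · Γ(1+1/p)/Γ(3/2+1/p))ⁿ`. -/
theorem lp_mahler_l1norm (n : ℕ) (hn : 1 ≤ n) (p : ℝ) (hp : 0 < p) :
    MpE p (fun x : Euc n => ((∑ i, |x i| : ℝ) : EReal)) =
      ENNReal.ofReal
        (((p + 1) ^ (1 + 1 / p) / p *
          (2 * Real.sqrt π * Real.Gamma (1 + 1 / p) / Real.Gamma (3 / 2 + 1 / p))) ^ n) := by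
  unfold MpE
  rw [lm_VolE]
  unfold VolE
  simp_rw [lm_star n p hp]
  rw [lm_lintegral_euc n (fun _ => lmG p) (fun _ => lmG_meas p), Finset.prod_const,
    Finset.card_univ, Fintype.card_fin, lm_G_int p hp, ← mul_pow]
  have g1 := Real.Gamma_pos_of_pos (by positivity : 0 < 1 + 1 / p)
  have g3 := Real.Gamma_pos_of_pos (by positivity : 0 < 3 / 2 + 1 / p)
  rw [ENNReal.ofReal_pow (by positivity)]
  congr 1
  rw [show (2 : ℝ≥0∞) = ENNReal.ofReal 2 by simp, ← ENNReal.ofReal_mul (by norm_num)]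
  congr 1
  ring

end
end

section
/- Let n ≥ 1 and let Δ_{n,+} := {x ∈ ℝⁿ : xᵢ ≥ 0 for all i and x₁ + … + xₙ ≤ 1}. For every y ∈ ℝⁿ whose coordinates y₁, …, yₙ are pairwise distinct and all nonzero, ∫_{Δ_{n,+}} e^{⟨x,y⟩} dx = Σ_{i=1}^{n} [ (e^{yᵢ} − 1)/yᵢ ] / ∏_{j≠i} (yᵢ − yⱼ). -/
open MeasureTheory Real Filter
open scoped ENNReal RealInnerProductSpace Classical

noncomputable section

def sxS (n : ℕ) (t : ℝ) : Set (Fin n → ℝ) := {x | (∀ i, 0 ≤ x i) ∧ ∑ i, x i ≤ t}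

def sxJ (n : ℕ) (t : ℝ) (y : Fin n → ℝ) : ℝ :=
  ∫ x, (sxS n t).indicator (fun x => Real.exp (∑ i, x i * y i)) x

theorem sxS_closed (n : ℕ) (t : ℝ) : IsClosed (sxS n t) := by
  unfold sxS
  simp only [Set.setOf_and, Set.setOf_forall]
  refine IsClosed.inter (isClosed_iInter fun i => ?_) ?_
  · exact isClosed_le continuous_const (continuous_apply i)
  · exact isClosed_le (by fun_prop) continuous_const

theorem sxS_integrable (n : ℕ) (t : ℝ) (y : Fin n → ℝ) :
    Integrable ((sxS n t).indicator (fun x => Real.exp (∑ i, x i * y i))) := by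
  rw [integrable_indicator_iff (sxS_closed n t).measurableSet]
  have h : Continuous (fun x : Fin n → ℝ => Real.exp (∑ i, x i * y i)) := by fun_prop
  refine (h.integrableOn_Icc (a := fun _ => 0) (b := fun _ => t)).mono_set ?_
  intro x hx
  refine ⟨fun i => hx.1 i, fun i => ?_⟩
  exact (Finset.single_le_sum (fun j _ => hx.1 j) (Finset.mem_univ i)).trans hx.2

theorem sxJ_succ (n : ℕ) (t : ℝ) (ht : 0 ≤ t) (y : Fin (n + 1) → ℝ) :
    sxJ (n + 1) t y =
      ∫ s in (0:ℝ)..t, Real.exp (s * y 0) * sxJ n (t - s) (fun i => y i.succ) := by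
  have mp := (volume_preserving_piFinSuccAbove (fun _ : Fin (n + 1) => ℝ) 0).symm
  have hint := (mp.integrable_comp_emb (MeasurableEquiv.measurableEmbedding _)).2
    (sxS_integrable (n + 1) t y)
  rw [sxJ, ← mp.integral_comp']
  have h1 := integral_prod _ hint
  refine Eq.trans h1 ?_
  rw [intervalIntegral.integral_of_le ht, ← integral_Icc_eq_integral_Ioc,
    ← integral_indicator measurableSet_Icc]
  congr 1
  ext s
  by_cases hs : s ∈ Set.Icc 0 t
  · rw [Set.indicator_of_mem hs, sxJ, ← integral_const_mul]
    congr 1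
    ext x
    have hiff : (MeasurableEquiv.piFinSuccAbove (fun _ : Fin (n + 1) => ℝ) 0).symm (s, x)
        ∈ sxS (n + 1) t ↔ x ∈ sxS n (t - s) := by
      simp only [sxS, Set.mem_setOf_eq, MeasurableEquiv.piFinSuccAbove_symm_apply,
        Fin.insertNthEquiv_zero, Fin.consEquiv_apply, Fin.forall_fin_succ, Fin.sum_univ_succ,
        Fin.cons_zero, Fin.cons_succ]
      constructor
      · rintro ⟨⟨_, h⟩, h'⟩; exact ⟨h, by linarith⟩
      · rintro ⟨h, h'⟩; exact ⟨⟨hs.1, h⟩, by linarith⟩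
    simp only [Function.comp_apply]
    by_cases hx : x ∈ sxS n (t - s)
    · rw [Set.indicator_of_mem hx, Set.indicator_of_mem (hiff.2 hx), ← Real.exp_add]
      simp [MeasurableEquiv.piFinSuccAbove_symm_apply, Fin.sum_univ_succ]
    · rw [Set.indicator_of_notMem hx, Set.indicator_of_notMem (fun h => hx (hiff.1 h)), mul_zero]
  · rw [Set.indicator_of_notMem hs]
    refine integral_eq_zero_of_ae (Eventually.of_forall fun x => ?_)
    simp only [Function.comp_apply, Pi.zero_apply]
    refine Set.indicator_of_notMem (fun h => hs ?_) _
    simp only [sxS, Set.mem_setOf_eq, MeasurableEquiv.piFinSuccAbove_symm_apply,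
        Fin.insertNthEquiv_zero, Fin.consEquiv_apply, Fin.forall_fin_succ, Fin.sum_univ_succ,
        Fin.cons_zero, Fin.cons_succ] at h
    have := Finset.sum_nonneg (fun i (_ : i ∈ Finset.univ) => h.1.2 i)
    exact ⟨h.1.1, by linarith [h.2]⟩

theorem sx_int (t a b : ℝ) (ha : a ≠ 0) (hb : b ≠ 0) (hab : a ≠ b) :
    ∫ s in (0:ℝ)..t, Real.exp (s * b) * ((Real.exp ((t - s) * a) - 1) / a) =
      ((Real.exp (t * a) - 1) / a - (Real.exp (t * b) - 1) / b) / (a - b) := by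
  have hba : b - a ≠ 0 := sub_ne_zero.2 hab.symm
  have hab' : a - b ≠ 0 := sub_ne_zero.2 hab
  have hd : ∀ s ∈ Set.uIcc 0 t, HasDerivAt
      (fun s : ℝ => (Real.exp (s * (b - a) + t * a) / (b - a) - Real.exp (s * b) / b) / a)
      (Real.exp (s * b) * ((Real.exp ((t - s) * a) - 1) / a)) s := by
    intro s _
    have h1 : HasDerivAt (fun s : ℝ => s * (b - a) + t * a) (b - a) s := by
      simpa using ((hasDerivAt_id s).mul_const (b - a)).add_const (t * a)
    have h2 : HasDerivAt (fun s : ℝ => s * b) b s := by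
      simpa using (hasDerivAt_id s).mul_const b
    refine (((h1.exp.div_const (b - a)).sub (h2.exp.div_const b)).div_const a).congr_deriv ?_
    rw [show s * (b - a) + t * a = s * b + (t - s) * a by ring, Real.exp_add]
    field_simp
  rw [intervalIntegral.integral_eq_sub_of_hasDerivAt hd
    (by apply Continuous.intervalIntegrable; fun_prop)]
  rw [show t * (b - a) + t * a = t * b by ring]
  simp only [zero_mul, zero_add, Real.exp_zero]
  field_simp
  ring

theorem sx_prod {n : ℕ} (i : Fin n) (f : Fin n → ℝ) :
    ∏ j ∈ Finset.univ.erase i, f j = ∏ j, if j = i then 1 else f j := by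
  rw [← Finset.mul_prod_erase Finset.univ _ (Finset.mem_univ i)]
  simp only [if_true, one_mul]
  refine Finset.prod_congr rfl fun j hj => ?_
  rw [if_neg (Finset.ne_of_mem_erase hj)]

theorem sx_lagrange {n : ℕ} (y : Fin (n + 1) → ℝ) (b : ℝ) (hy : Function.Injective y)
    (hb : ∀ i, y i ≠ b) :
    ∑ i, 1 / ((y i - b) * ∏ j ∈ Finset.univ.erase i, (y i - y j)) =
      - (1 / ∏ j, (b - y j)) := by
  have h := congrArg (Polynomial.eval b)
    (Lagrange.sum_basis (s := Finset.univ) (v := y) hy.injOn ⟨0, Finset.mem_univ _⟩)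
  simp only [Polynomial.eval_finset_sum, Polynomial.eval_one, Lagrange.basis,
    Polynomial.eval_prod, Lagrange.basisDivisor, Polynomial.eval_mul, Polynomial.eval_C,
    Polynomial.eval_sub, Polynomial.eval_X] at h
  have hP : ∏ j, (b - y j) ≠ 0 := Finset.prod_ne_zero_iff.2 fun j _ => sub_ne_zero.2 (hb j).symm
  rw [← neg_eq_iff_eq_neg, eq_div_iff hP, ← Finset.sum_neg_distrib, Finset.sum_mul]
  refine Eq.trans ?_ h
  refine Finset.sum_congr rfl fun i _ => ?_
  rw [Finset.prod_mul_distrib, Finset.prod_inv_distrib,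
    ← Finset.mul_prod_erase Finset.univ (fun j => b - y j) (Finset.mem_univ i)]
  have h1 : y i - b ≠ 0 := sub_ne_zero.2 (hb i)
  have h2 : ∏ j ∈ Finset.univ.erase i, (y i - y j) ≠ 0 := Finset.prod_ne_zero_iff.2 fun j hj =>
    sub_ne_zero.2 fun e => Finset.ne_of_mem_erase hj (hy e).symm
  field_simp
  ring

theorem sxJ_formula (n : ℕ) : ∀ (t : ℝ) (_ : 0 ≤ t) (y : Fin (n + 1) → ℝ)
    (_ : Function.Injective y) (_ : ∀ i, y i ≠ 0),
    sxJ (n + 1) t y = ∑ i, ((Real.exp (t * y i) - 1) / y i) /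
        ∏ j ∈ Finset.univ.erase i, (y i - y j) := by
  induction n with
  | zero =>
    intro t ht y hy hne
    rw [sxJ_succ 0 t ht]
    have h0 : ∀ s ∈ Set.uIcc 0 t,
        Real.exp (s * y 0) * sxJ 0 (t - s) (fun i => y i.succ) = Real.exp (s * y 0) := by
      intro s hs
      rw [Set.uIcc_of_le ht] at hs
      have : sxS 0 (t - s) = Set.univ := by
        ext x; simpa [sxS] using hs.2
      rw [sxJ, this]
      simp [integral_unique, measureReal_def, volume_pi]
    rw [intervalIntegral.integral_congr h0, intervalIntegral.integral_comp_mul_right _ (hne 0)]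
    simp [div_eq_inv_mul, sx_prod]
  | succ n ih =>
    intro t ht y hy hne
    have hinj : Function.Injective (fun i : Fin (n + 1) => y i.succ) :=
      hy.comp (Fin.succ_injective _)
    have hb : ∀ i : Fin (n + 1), y i.succ ≠ y 0 := fun i e => Fin.succ_ne_zero i (hy e)
    rw [sxJ_succ _ t ht]
    have h0 : ∀ s ∈ Set.uIcc 0 t,
        Real.exp (s * y 0) * sxJ (n + 1) (t - s) (fun i => y i.succ) =
        ∑ i : Fin (n + 1), (Real.exp (s * y 0) *
          ((Real.exp ((t - s) * y i.succ) - 1) / y i.succ)) *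
          (∏ j ∈ Finset.univ.erase i, (y i.succ - y j.succ))⁻¹ := by
      intro s hs
      rw [Set.uIcc_of_le ht] at hs
      rw [ih (t - s) (sub_nonneg.2 hs.2) _ hinj (fun i => hne _), Finset.mul_sum]
      refine Finset.sum_congr rfl fun i _ => ?_
      rw [div_eq_mul_inv _ (∏ j ∈ _, _), mul_assoc]
    rw [intervalIntegral.integral_congr h0, intervalIntegral.integral_finset_sum
      (fun i _ => by apply Continuous.intervalIntegrable; fun_prop)]
    simp only [intervalIntegral.integral_mul_const]
    simp only [sx_int t _ _ (hne _) (hne 0) (hb _)]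
    have hl := sx_lagrange (fun i : Fin (n + 1) => y i.succ) (y 0) hinj hb
    rw [Fin.sum_univ_succ (n := n + 1)]
    have e0 : ∏ j ∈ Finset.univ.erase (0 : Fin (n + 2)), (y 0 - y j) =
        ∏ j : Fin (n + 1), (y 0 - y j.succ) := by
      rw [sx_prod, Fin.prod_univ_succ]; simp [Fin.succ_ne_zero]
    have e1 : ∀ i : Fin (n + 1), ∏ j ∈ Finset.univ.erase i.succ, (y i.succ - y j) =
        (y i.succ - y 0) * ∏ j ∈ Finset.univ.erase i, (y i.succ - y j.succ) := by
      intro i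
      rw [sx_prod, sx_prod, Fin.prod_univ_succ, if_neg (Fin.succ_ne_zero i).symm]
      simp only [Fin.succ_inj]
    rw [e0]
    simp only [e1]
    have e2 : (Real.exp (t * y 0) - 1) / y 0 / ∏ j : Fin (n + 1), (y 0 - y j.succ) =
        ∑ i : Fin (n + 1), -((Real.exp (t * y 0) - 1) / y 0) *
          (1 / ((y i.succ - y 0) * ∏ j ∈ Finset.univ.erase i, (y i.succ - y j.succ))) := by
      rw [← Finset.mul_sum, hl]; ring
    rw [e2, ← Finset.sum_add_distrib]
    refine Finset.sum_congr rfl fun i _ => ?_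
    generalize ∏ j ∈ Finset.univ.erase i, (y i.succ - y j.succ) = P
    generalize (Real.exp (t * y 0) - 1) / y 0 = A
    generalize (Real.exp (t * y i.succ) - 1) / y i.succ = B
    generalize y i.succ - y 0 = D
    simp only [div_eq_mul_inv, mul_inv]
    ring

/-- the exponential integral over the standard simplex:
for `y` with pairwise distinct nonzero coordinates,
`∫_{Δ_{n,+}} e^{⟨x,y⟩} dx = Σᵢ ((e^{yᵢ}−1)/yᵢ) / ∏_{j≠i} (yᵢ−yⱼ)`. -/
theorem simplex_exp_integral (n : ℕ) (hn : 1 ≤ n) (y : Euc n)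
    (hdist : ∀ i j : Fin n, i ≠ j → y i ≠ y j) (hne : ∀ i : Fin n, y i ≠ 0) :
    ∫ x in {x : Euc n | (∀ i, 0 ≤ x i) ∧ ∑ i, x i ≤ 1}, Real.exp ⟪x, y⟫ =
      ∑ i : Fin n, ((Real.exp (y i) - 1) / y i) /
        ∏ j ∈ Finset.univ.erase i, (y i - y j) := by
  obtain ⟨m, rfl⟩ : ∃ m, n = m + 1 := ⟨n - 1, by omega⟩
  have hinj : Function.Injective (fun i => y i) := by
    intro i j h
    by_contra hij
    exact hdist i j hij h
  have h := sxJ_formula m 1 zero_le_one (fun i => y i) hinj hne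
  simp only [one_mul] at h
  rw [← h, sxJ, integral_indicator (sxS_closed _ _).measurableSet,
    ← (EuclideanSpace.volume_preserving_symm_measurableEquiv_toLp (Fin (m + 1))).setIntegral_preimage_emb
      (MeasurableEquiv.measurableEmbedding _)]
  refine congrArg₂ _ rfl ?_
  ext x
  simp [PiLp.inner_apply, mul_comm]

end
end
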